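/- Every isometry φ of the invariant lattice Λ^σ ≅ U³ ⊕ E8(-2) ⊕ ⟨-2⟩ extends to an isometry Φ of Λ = U³ ⊕ E8(-1)² ⊕ ⟨-2⟩ (where σ swaps the two E8(-1) summands and Λ^σ is embedded diagonally). -/

import Mathlib

/-- A Gram matrix of the `E8` root lattice (the Cartan matrix of `E8`):
even, unimodular, positive definite of rank `8`. -/
def gramE8 : Matrix (Fin 8) (Fin 8) ℤ :=
  !![ 2,-1, 0, 0, 0, 0, 0, 0;
     -1, 2,-1, 0, 0, 0, 0, 0;
      0,-1, 2,-1, 0, 0, 0,-1;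
      0, 0,-1, 2,-1, 0, 0, 0;
      0, 0, 0,-1, 2,-1, 0, 0;
      0, 0, 0, 0,-1, 2,-1, 0;
      0, 0, 0, 0, 0,-1, 2, 0;
      0, 0,-1, 0, 0, 0, 0, 2]

/-- The Gram matrix of `U³`, three copies of the hyperbolic plane. -/
def gramU3 : Matrix (Fin 6) (Fin 6) ℤ :=
  !![0,1,0,0,0,0; 1,0,0,0,0,0;
     0,0,0,1,0,0; 0,0,1,0,0,0;
     0,0,0,0,0,1; 0,0,0,0,1,0]

/-- The bilinear form of the `E8` lattice on `ℤ^8`. -/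
noncomputable def bE8 : LinearMap.BilinForm ℤ (Fin 8 → ℤ) := Matrix.toBilin' gramE8

/-- The bilinear form of `U³` on `ℤ^6`. -/
noncomputable def bU3 : LinearMap.BilinForm ℤ (Fin 6 → ℤ) := Matrix.toBilin' gramU3

/-- The underlying group of the lattice `Λ = U³ ⊕ E8(-1) ⊕ E8(-1) ⊕ ⟨-2⟩`
(the `K3^[2]` lattice). -/
abbrev LamK3 : Type := (Fin 6 → ℤ) × (Fin 8 → ℤ) × (Fin 8 → ℤ) × ℤ

noncomputable def bLamK3 : LinearMap.BilinForm ℤ LamK3 :=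
  bU3.compl₁₂ (LinearMap.fst ℤ _ _) (LinearMap.fst ℤ _ _)
  - bE8.compl₁₂ ((LinearMap.fst ℤ _ _).comp (LinearMap.snd ℤ _ _))
      ((LinearMap.fst ℤ _ _).comp (LinearMap.snd ℤ _ _))
  - bE8.compl₁₂
      ((LinearMap.fst ℤ _ _).comp ((LinearMap.snd ℤ _ _).comp (LinearMap.snd ℤ _ _)))
      ((LinearMap.fst ℤ _ _).comp ((LinearMap.snd ℤ _ _).comp (LinearMap.snd ℤ _ _)))
  - (2 : ℤ) • ((LinearMap.mul ℤ ℤ).compl₁₂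
      ((LinearMap.snd ℤ _ _).comp ((LinearMap.snd ℤ _ _).comp (LinearMap.snd ℤ _ _)))
      ((LinearMap.snd ℤ _ _).comp ((LinearMap.snd ℤ _ _).comp (LinearMap.snd ℤ _ _))))

/-- The involution `σ` of `Λ` swapping the two `E8(-1)` summands. -/
def sigmaK3 : LamK3 ≃ₗ[ℤ] LamK3 where
  toFun p := (p.1, p.2.2.1, p.2.1, p.2.2.2)
  invFun p := (p.1, p.2.2.1, p.2.1, p.2.2.2)
  map_add' _ _ := rfl
  map_smul' _ _ := rfl
  left_inv _ := rfl
  right_inv _ := rfl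

/-- The invariant sublattice `Λ^σ = {v : σ v = v}`. -/
def FixK3 : Submodule ℤ LamK3 :=
  LinearMap.ker (sigmaK3.toLinearMap - LinearMap.id)

/-- The underlying group of the lattice `T = U³ ⊕ E8(-2) ⊕ ⟨-2⟩`. -/
abbrev TK3 : Type := (Fin 6 → ℤ) × (Fin 8 → ℤ) × ℤ

/-- The bilinear form of `T = U³ ⊕ E8(-2) ⊕ ⟨-2⟩`. -/
noncomputable def bTK3 : LinearMap.BilinForm ℤ TK3 :=
  bU3.compl₁₂ (LinearMap.fst ℤ _ _) (LinearMap.fst ℤ _ _)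
  - (2 : ℤ) • (bE8.compl₁₂ ((LinearMap.fst ℤ _ _).comp (LinearMap.snd ℤ _ _))
      ((LinearMap.fst ℤ _ _).comp (LinearMap.snd ℤ _ _)))
  - (2 : ℤ) • ((LinearMap.mul ℤ ℤ).compl₁₂
      ((LinearMap.snd ℤ _ _).comp (LinearMap.snd ℤ _ _))
      ((LinearMap.snd ℤ _ _).comp (LinearMap.snd ℤ _ _)))

/-- The diagonal embedding `U³ ⊕ E8(-2) ⊕ ⟨-2⟩ → Λ`, `u ⊕ e ⊕ kδ ↦ u ⊕ e ⊕ e ⊕ kδ`. -/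
def embDiag : TK3 →ₗ[ℤ] LamK3 where
  toFun p := (p.1, p.2.1, p.2.1, p.2.2)
  map_add' _ _ := rfl
  map_smul' _ _ := rfl

/-- Half the norm form of the `E8` lattice. -/
def qE8 (v : Fin 8 → ℤ) : ℤ :=
  v 0 ^ 2 + v 1 ^ 2 + v 2 ^ 2 + v 3 ^ 2 + v 4 ^ 2 + v 5 ^ 2 + v 6 ^ 2 + v 7 ^ 2
    - (v 0 * v 1 + v 1 * v 2 + v 2 * v 3 + v 3 * v 4 + v 4 * v 5 + v 5 * v 6 + v 2 * v 7)

theorem bE8_self (v : Fin 8 → ℤ) : bE8 v v = 2 * qE8 v := by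
  simp [bE8, Matrix.toBilin'_apply, Fin.sum_univ_eight, gramE8, qE8]
  ring

theorem bE8_comm (v w : Fin 8 → ℤ) : bE8 v w = bE8 w v := by
  simp [bE8, Matrix.toBilin'_apply, Fin.sum_univ_eight, gramE8]
  ring

theorem sum_sq_eq_qE8 (v : Fin 8 → ℤ) :
    30 * (2 * v 0 - v 1) ^ 2 + 10 * (3 * v 1 - 2 * v 2) ^ 2 + 30 * (2 * v 7 - v 2) ^ 2
      + 30 * (2 * v 6 - v 5) ^ 2 + 10 * (3 * v 5 - 2 * v 4) ^ 2 + 5 * (4 * v 4 - 3 * v 3) ^ 2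
      + 3 * (5 * v 3 - 4 * v 2) ^ 2 + 2 * v 2 ^ 2 = 120 * qE8 v := by
  simp only [qE8]; ring

theorem qE8_nonneg (v : Fin 8 → ℤ) : 0 ≤ qE8 v := by
  have h := sum_sq_eq_qE8 v
  have : 0 ≤ 120 * qE8 v := by rw [← h]; positivity
  omega

theorem eq_zero_of_qE8_eq_zero {v : Fin 8 → ℤ} (hv : qE8 v = 0) : v = 0 := by
  have h := sum_sq_eq_qE8 v
  rw [hv, mul_zero] at h
  repeat rw [add_eq_zero_iff_of_nonneg (by positivity) (by positivity)] at h
  simp only [mul_eq_zero, pow_eq_zero_iff, OfNat.ofNat_ne_zero, ne_eq, not_false_eq_true,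
    false_or] at h
  funext i
  fin_cases i <;> simp <;> omega

theorem qE8_add (v w : Fin 8 → ℤ) : qE8 (v + w) = qE8 v + qE8 w + bE8 v w := by
  have h := bE8_self (v + w)
  simp only [map_add, LinearMap.add_apply, bE8_self, bE8_comm w v] at h
  linarith

theorem qE8_smul (k : ℤ) (v : Fin 8 → ℤ) : qE8 (k • v) = k ^ 2 * qE8 v := by
  simp only [qE8, Pi.smul_apply, smul_eq_mul]; ring

/-- Vectors `w` such that every `0`-`1` vector of odd half-norm becomes a root after
subtracting `2 w` for one of them. -/
def rootShifts : List (Fin 8 → ℤ) :=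
  [![0, 0, 0, 0, 0, 0, 0, 0], ![0, 0, -1, 0, 0, 0, 0, 0], ![1, 1, 1, 1, 1, 1, 1, 1],
   ![1, 1, 2, 1, 1, 1, 1, 1], ![1, 1, 2, 2, 1, 1, 1, 1], ![0, 0, -1, -1, 0, 0, 0, 0],
   ![1, 2, 3, 2, 2, 1, 1, 2], ![1, 1, 1, 1, 1, 1, 0, 1], ![1, 1, 2, 1, 1, 1, 0, 1],
   ![1, 2, 2, 2, 1, 1, 1, 1], ![1, 1, 2, 2, 2, 1, 1, 1], ![1, 2, 2, 2, 2, 1, 1, 1],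
   ![1, 1, 2, 2, 1, 1, 0, 1], ![1, 2, 3, 2, 2, 1, 1, 1], ![0, 0, -1, -1, -1, 0, 0, 0],
   ![1, 2, 2, 2, 1, 1, 0, 1], ![-1, -2, -3, -2, -2, -1, 0, -1], ![0, -1, -1, 0, 0, 0, 0, 0],
   ![0, -1, -1, -1, 0, 0, 0, 0], ![-1, -2, -3, -2, -1, -1, 0, -1],
   ![-1, -2, -3, -2, -2, -1, -1, -1], ![0, 0, -1, -1, -1, -1, 0, 0],
   ![0, -1, -1, -1, 0, 0, 0, -1]]

theorem exists_rootShift :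
    ∀ a b c d e f g h : Fin 2,
      let v : Fin 8 → ℤ := ![a.val, b.val, c.val, d.val, e.val, f.val, g.val, h.val]
      qE8 v % 2 = 1 → ∃ w ∈ rootShifts, qE8 (v - (2 : ℤ) • w) = 1 := by
  decide +kernel

/-- Every class of `E8 / 2 E8` of odd half-norm contains a root. -/
theorem exists_root_congr {v : Fin 8 → ℤ} (hv : qE8 v % 2 = 1) :
    ∃ r w : Fin 8 → ℤ, v = r + (2 : ℤ) • w ∧ qE8 r = 1 := by
  have hlt : ∀ i, (v i % 2).toNat < 2 := fun i => by omega
  let x : Fin 8 → Fin 2 := fun i => ⟨(v i % 2).toNat, hlt i⟩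
  have key := exists_rootShift (x 0) (x 1) (x 2) (x 3) (x 4) (x 5) (x 6) (x 7)
  set y : Fin 8 → ℤ := ![(x 0).val, (x 1).val, (x 2).val, (x 3).val, (x 4).val, (x 5).val,
    (x 6).val, (x 7).val] with hy
  have hyv : v = y + (2 : ℤ) • fun i => v i / 2 := by
    funext i
    fin_cases i <;> simp [hy, x] <;> omega
  have hyq : qE8 y % 2 = 1 := by
    rw [hyv, qE8_add, qE8_smul, map_smul, smul_eq_mul] at hv
    omega
  obtain ⟨w, -, hw⟩ := key hyq
  refine ⟨_, w + fun i => v i / 2, ?_, hw⟩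
  rw [smul_add, ← add_assoc, sub_add_cancel]
  exact hyv

theorem neg_one_le_bE8 {r s : Fin 8 → ℤ} (hr : qE8 r = 1) (hs : qE8 s = 1) (h : s ≠ -r) :
    -1 ≤ bE8 r s := by
  have h1 := qE8_add r s
  have h2 := qE8_nonneg (r + s)
  have h3 : qE8 (r + s) ≠ 0 := fun h0 =>
    h (eq_neg_of_add_eq_zero_right (eq_zero_of_qE8_eq_zero h0))
  omega

theorem qE8_neg (v : Fin 8 → ℤ) : qE8 (-v) = qE8 v := by
  simpa using qE8_smul (-1) v

theorem abs_bE8_le_one {r s : Fin 8 → ℤ} (hr : qE8 r = 1) (hs : qE8 s = 1) (h : s ≠ -r)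
    (h' : s ≠ r) : -1 ≤ bE8 r s ∧ bE8 r s ≤ 1 := by
  refine ⟨neg_one_le_bE8 hr hs h, ?_⟩
  have := neg_one_le_bE8 (r := -r) (s := s) (by rw [qE8_neg, hr]) hs (by rwa [neg_neg])
  rw [map_neg, LinearMap.neg_apply] at this
  omega

theorem gramE8_isSymm : gramE8.IsSymm := by decide

theorem gramE8_off_diag : ∀ i j, i ≠ j → -1 ≤ gramE8 i j ∧ gramE8 i j ≤ 0 := by
  intro i
  fin_cases i <;> decide

theorem gramE8_nonneg_or_edge : ∀ i j : Fin 8, i < j → 0 ≤ gramE8 i j ∨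
    (i, j) ∈ [((0 : Fin 8), (1 : Fin 8)), (1, 2), (2, 3), (3, 4), (4, 5), (5, 6), (2, 7)] := by
  intro i
  fin_cases i <;> decide

theorem gramE8_diag : ∀ i, gramE8 i i = 2 := by decide

/-- Since the `E8` diagram is a tree, the Gram matrix of roots that is congruent to the one of `E8`
modulo `2` agrees with it after changing signs. -/
theorem exists_signs {c : Fin 8 → Fin 8 → ℤ} (hd : ∀ i, c i i = 2) (hs : ∀ i j, c i j = c j i)
    (hc : ∀ i j, i ≠ j → -1 ≤ c i j ∧ c i j ≤ 1) (hp : ∀ i j, c i j % 2 = gramE8 i j % 2) :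
    ∃ s : Fin 8 → ℤ, (∀ i, s i = 1 ∨ s i = -1) ∧ ∀ i j, s i * s j * c i j = gramE8 i j := by
  have unit : ∀ i j, i ≠ j → gramE8 i j = -1 → c i j = 1 ∨ c i j = -1 := fun i j hij h => by
    have := hc i j hij
    have := hp i j
    omega
  have zero : ∀ i j, i ≠ j → gramE8 i j = 0 → c i j = 0 := fun i j hij h => by
    have := hc i j hij
    have := hp i j
    omega
  let s1 := -c 0 1
  let s2 := -(s1 * c 1 2)
  let s3 := -(s2 * c 2 3)
  let s4 := -(s3 * c 3 4)
  let s5 := -(s4 * c 4 5)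
  let s6 := -(s5 * c 5 6)
  let s7 := -(s2 * c 2 7)
  have step : ∀ {x y z : ℤ}, (x = 1 ∨ x = -1) → (y = 1 ∨ y = -1) → z = -(x * y) →
      (z = 1 ∨ z = -1) ∧ x * z * y = -1 := by
    rintro x y z (rfl | rfl) (rfl | rfl) rfl <;> simp
  obtain ⟨u1, e1⟩ := step (x := 1) (z := s1) (by simp) (unit 0 1 (by decide) (by decide))
    (by simp [s1])
  obtain ⟨u2, e2⟩ := step (z := s2) u1 (unit 1 2 (by decide) (by decide)) rfl
  obtain ⟨u3, e3⟩ := step (z := s3) u2 (unit 2 3 (by decide) (by decide)) rfl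
  obtain ⟨u4, e4⟩ := step (z := s4) u3 (unit 3 4 (by decide) (by decide)) rfl
  obtain ⟨u5, e5⟩ := step (z := s5) u4 (unit 4 5 (by decide) (by decide)) rfl
  obtain ⟨u6, e6⟩ := step (z := s6) u5 (unit 5 6 (by decide) (by decide)) rfl
  obtain ⟨u7, e7⟩ := step (z := s7) u2 (unit 2 7 (by decide) (by decide)) rfl
  clear_value s1 s2 s3 s4 s5 s6 s7
  let s : Fin 8 → ℤ := ![1, s1, s2, s3, s4, s5, s6, s7]
  have hu : ∀ i, s i = 1 ∨ s i = -1 := by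
    intro i
    fin_cases i
    exacts [Or.inl rfl, u1, u2, u3, u4, u5, u6, u7]
  have edge : ∀ i j, i < j → gramE8 i j = -1 → s i * s j * c i j = -1 := by
    intro i j hij hg
    have := (gramE8_nonneg_or_edge i j hij).resolve_left (by omega)
    simp only [List.mem_cons, Prod.mk.injEq, List.not_mem_nil, or_false] at this
    rcases this with ⟨rfl, rfl⟩ | ⟨rfl, rfl⟩ | ⟨rfl, rfl⟩ | ⟨rfl, rfl⟩ | ⟨rfl, rfl⟩ |
      ⟨rfl, rfl⟩ | ⟨rfl, rfl⟩
    exacts [e1, e2, e3, e4, e5, e6, e7]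
  have upper : ∀ i j, i < j → s i * s j * c i j = gramE8 i j := by
    intro i j hij
    have : gramE8 i j = -1 ∨ gramE8 i j = 0 := by
      have := gramE8_off_diag i j hij.ne
      omega
    rcases this with h | h
    · rw [edge i j hij h, h]
    · rw [zero i j hij.ne h, h, mul_zero]
  refine ⟨s, hu, fun i j => ?_⟩
  rcases lt_trichotomy i j with h | rfl | h
  · exact upper i j h
  · rcases hu i with h | h <;> simp [h, hd, gramE8_diag]
  · rw [gramE8_isSymm.apply, ← upper j i h, hs i j]
    ring

/-- The inverse of the Gram matrix of the `E8` lattice. -/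
def invGramE8 : Matrix (Fin 8) (Fin 8) ℤ :=
  !![4, 7, 10, 8, 6, 4, 2, 5;
     7, 14, 20, 16, 12, 8, 4, 10;
     10, 20, 30, 24, 18, 12, 6, 15;
     8, 16, 24, 20, 15, 10, 5, 12;
     6, 12, 18, 15, 12, 8, 4, 9;
     4, 8, 12, 10, 8, 6, 3, 6;
     2, 4, 6, 5, 4, 3, 2, 3;
     5, 10, 15, 12, 9, 6, 3, 8]

theorem invGramE8_mul : invGramE8 * gramE8 = 1 := by decide +kernel

theorem bE8_single (i j : Fin 8) : bE8 (Pi.single i 1) (Pi.single j 1) = gramE8 i j :=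
  Matrix.toBilin'_single _ _ _

open Matrix in
/-- A family of vectors with the Gram matrix of `E8` is the image of the standard basis under
an isometry. -/
theorem exists_isometry_of_gram {r : Fin 8 → Fin 8 → ℤ}
    (hr : ∀ i j, bE8 (r i) (r j) = gramE8 i j) :
    ∃ ψ : (Fin 8 → ℤ) ≃ₗ[ℤ] (Fin 8 → ℤ),
      (∀ f g, bE8 (ψ f) (ψ g) = bE8 f g) ∧ ∀ i, ψ (Pi.single i 1) = r i := by
  let M : Matrix (Fin 8) (Fin 8) ℤ := (Matrix.of r)ᵀ
  have hcol : ∀ i, Matrix.toLin' M (Pi.single i 1) = r i := fun i => by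
    rw [Matrix.toLin'_apply, Matrix.mulVec_single_one]; rfl
  have hiso : bE8.compl₁₂ (Matrix.toLin' M) (Matrix.toLin' M) = bE8 :=
    LinearMap.BilinForm.ext_basis (Pi.basisFun ℤ (Fin 8)) fun i j => by
      simp only [LinearMap.compl₁₂_apply, Pi.basisFun_apply]
      rw [hcol, hcol, hr, bE8_single]
  have hM : Mᵀ * gramE8 * M = gramE8 :=
    Matrix.toBilin'.injective ((Matrix.toBilin'_comp gramE8 M M).symm.trans hiso)
  have hinv : invGramE8 * Mᵀ * gramE8 * M = 1 := by
    rw [Matrix.mul_assoc, Matrix.mul_assoc, ← Matrix.mul_assoc Mᵀ, hM, invGramE8_mul]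
  refine ⟨Matrix.toLin'OfInv hinv (mul_eq_one_comm.mp hinv), fun f g => ?_, fun i => ?_⟩
  · exact LinearMap.congr_fun₂ hiso f g
  · exact hcol i

theorem exists_isometry_congr (A : (Fin 8 → ℤ) →ₗ[ℤ] (Fin 8 → ℤ))
    (hA : ∀ f, ∃ k, qE8 (A f) = qE8 f + 2 * k) :
    ∃ ψ : (Fin 8 → ℤ) ≃ₗ[ℤ] (Fin 8 → ℤ),
      (∀ f g, bE8 (ψ f) (ψ g) = bE8 f g) ∧ ∀ f, ∃ w, A f = ψ f + (2 : ℤ) • w := by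
  have hb : ∀ f g, bE8 (A f) (A g) % 2 = bE8 f g % 2 := fun f g => by
    obtain ⟨k, hk⟩ := hA f
    obtain ⟨l, hl⟩ := hA g
    obtain ⟨m, hm⟩ := hA (f + g)
    rw [map_add, qE8_add, qE8_add] at hm
    omega
  have hroot : ∀ i : Fin 8, ∃ r w : Fin 8 → ℤ,
      A (Pi.single i 1) = r + (2 : ℤ) • w ∧ qE8 r = 1 := fun i => by
    apply exists_root_congr
    obtain ⟨k, hk⟩ := hA (Pi.single i 1)
    have := bE8_self (Pi.single i 1)
    rw [bE8_single, gramE8_diag] at this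
    omega
  choose r w hrw hr using hroot
  have hp : ∀ i j, bE8 (r i) (r j) % 2 = gramE8 i j % 2 := fun i j => by
    have := hb (Pi.single i 1) (Pi.single j 1)
    rw [bE8_single, hrw, hrw] at this
    simp only [map_add, map_smul, LinearMap.add_apply, LinearMap.smul_apply, smul_eq_mul] at this
    omega
  have hsep : ∀ i j, i ≠ j → ∃ k, gramE8 i k % 2 ≠ gramE8 j k % 2 := by decide
  have hc : ∀ i j, i ≠ j → -1 ≤ bE8 (r i) (r j) ∧ bE8 (r i) (r j) ≤ 1 := fun i j hij => by
    obtain ⟨k, hk⟩ := hsep i j hij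
    have hi := hp i k
    have hj := hp j k
    apply abs_bE8_le_one (hr i) (hr j)
    · intro h
      rw [h, map_neg, LinearMap.neg_apply] at hj
      omega
    · intro h
      rw [h] at hj
      omega
  obtain ⟨s, hs, hsc⟩ := exists_signs (c := fun i j => bE8 (r i) (r j))
    (fun i => by rw [bE8_self, hr, mul_one]) (fun i j => bE8_comm _ _) hc hp
  obtain ⟨ψ, hψ, hψr⟩ := exists_isometry_of_gram (r := fun i => s i • r i) fun i j => by
    rw [← hsc]
    simp only [map_smul, LinearMap.smul_apply, smul_eq_mul]
    ring
  refine ⟨ψ, hψ, fun f => ?_⟩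
  have hbasis : ∀ i : Fin 8, ∃ w, A (Pi.single i 1) = ψ (Pi.single i 1) + (2 : ℤ) • w := fun i => by
    rw [hψr, hrw]
    rcases hs i with h | h
    · exact ⟨w i, by rw [h, one_smul]⟩
    · exact ⟨r i + w i, by rw [h]; module⟩
  choose v hv using hbasis
  refine ⟨∑ i, f i • v i, ?_⟩
  have hf : ∀ L : (Fin 8 → ℤ) →ₗ[ℤ] (Fin 8 → ℤ), L f = ∑ i, f i • L (Pi.single i 1) := fun L => by
    conv_lhs => rw [pi_eq_sum_univ' f]
    simp only [map_sum, map_smul]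
  rw [hf A, ← LinearEquiv.coe_coe, hf ψ]
  simp only [LinearEquiv.coe_coe, Finset.smul_sum, ← Finset.sum_add_distrib, hv, smul_add,
    smul_comm (2 : ℤ)]

theorem bU3_self_even (u : Fin 6 → ℤ) : ∃ k, bU3 u u = 2 * k := by
  refine ⟨u 0 * u 1 + u 2 * u 3 + u 4 * u 5, ?_⟩
  simp [bU3, Matrix.toBilin'_apply, Fin.sum_univ_six, gramU3]
  ring

theorem exists_eq_two_smul_of_even_bU3 {u : Fin 6 → ℤ} (h : ∀ v, ∃ k, bU3 u v = 2 * k) :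
    ∃ w, u = (2 : ℤ) • w := by
  have key : ∀ i, ∃ k, u i = 2 * k := by
    intro i
    obtain ⟨k, hk⟩ := h (Pi.single (![1, 0, 3, 2, 5, 4] i) 1)
    refine ⟨k, hk ▸ ?_⟩
    fin_cases i <;> simp [bU3, Matrix.toBilin'_apply, Fin.sum_univ_six, gramU3, Pi.single_apply]
  choose w hw using key
  exact ⟨w, funext hw⟩

theorem bTK3_apply (s t : TK3) :
    bTK3 s t = bU3 s.1 t.1 - 2 * bE8 s.2.1 t.2.1 - 2 * (s.2.2 * t.2.2) := by
  simp [bTK3]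

theorem bLamK3_apply (x y : LamK3) :
    bLamK3 x y = bU3 x.1 y.1 - bE8 x.2.1 y.2.1 - bE8 x.2.2.1 y.2.2.1
      - 2 * (x.2.2.2 * y.2.2.2) := by
  simp [bLamK3]

/-- The inclusion of `E8(-2)` in `T`. -/
def inclE8 : (Fin 8 → ℤ) →ₗ[ℤ] TK3 where
  toFun e := (0, e, 0)
  map_add' _ _ := by simp
  map_smul' _ _ := by simp

/-- The antidiagonal embedding of `E8(-2)` in `Λ`. -/
def embAnti : (Fin 8 → ℤ) →ₗ[ℤ] LamK3 where
  toFun e := (0, e, -e, 0)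
  map_add' _ _ := by simp [add_comm]
  map_smul' _ _ := by simp

/-- An isometry of `T` maps `E8(-2)` into the vectors whose `U³` and `⟨-2⟩` components are even:
it preserves the part `A_{E8(-2)}` of the discriminant group. -/
theorem isometry_inclE8 {φ : TK3 ≃ₗ[ℤ] TK3} (hφ : ∀ s t : TK3, bTK3 (φ s) (φ t) = bTK3 s t)
    (e : Fin 8 → ℤ) :
    ∃ u k, φ (inclE8 e) = ((2 : ℤ) • u, (φ (inclE8 e)).2.1, 2 * k) := by
  have hdual : ∀ t, ∃ k, bTK3 (φ (inclE8 e)) t = 2 * k := fun t => by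
    refine ⟨- bE8 e (φ.symm t).2.1, ?_⟩
    rw [← φ.apply_symm_apply t, hφ, bTK3_apply, φ.symm_apply_apply]
    simp [inclE8]
  obtain ⟨u, hu⟩ := exists_eq_two_smul_of_even_bU3 (u := (φ (inclE8 e)).1) fun v => by
    obtain ⟨k, hk⟩ := hdual (v, 0, 0)
    exact ⟨k, by simpa [bTK3_apply] using hk⟩
  have hk : Even (φ (inclE8 e)).2.2 := by
    have h := hφ (inclE8 e) (inclE8 e)
    obtain ⟨l, hl⟩ := bU3_self_even u
    generalize φ (inclE8 e) = c at h hu ⊢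
    rw [bTK3_apply, bTK3_apply, hu, bE8_self] at h
    simp only [inclE8, LinearMap.coe_mk, AddHom.coe_mk, bE8_self, map_smul, map_zero,
      LinearMap.smul_apply, hl, smul_eq_mul] at h
    rw [← Int.even_pow' two_ne_zero, Int.even_iff, pow_two]
    omega
  obtain ⟨k, hk⟩ := hk
  exact ⟨u, k, Prod.ext hu (Prod.ext rfl (by rw [hk]; ring))⟩

/-- The invariant component of `2 x`, as an element of `T`. -/
def twiceProj : LamK3 →ₗ[ℤ] TK3 where
  toFun x := ((2 : ℤ) • x.1, x.2.1 + x.2.2.1, 2 * x.2.2.2)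
  map_add' _ _ := by
    ext <;> simp <;> ring
  map_smul' _ _ := by
    ext <;> simp <;> ring

/-- The anti-invariant component of `2 x`, as an element of `E8(-2)`. -/
def twiceAnti : LamK3 →ₗ[ℤ] (Fin 8 → ℤ) where
  toFun x := x.2.1 - x.2.2.1
  map_add' _ _ := by simp; abel
  map_smul' _ _ := by simp [smul_sub]

theorem two_smul_eq_embDiag_add_embAnti (x : LamK3) :
    (2 : ℤ) • x = embDiag (twiceProj x) + embAnti (twiceAnti x) := by
  ext <;> simp [embDiag, embAnti, twiceProj, twiceAnti] <;> ring

theorem twiceProj_embDiag_add_embAnti (t : TK3) (e : Fin 8 → ℤ) :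
    twiceProj (embDiag t + embAnti e) = (2 : ℤ) • t := by
  ext <;> simp [embDiag, embAnti, twiceProj]; ring

theorem twiceAnti_embDiag_add_embAnti (t : TK3) (e : Fin 8 → ℤ) :
    twiceAnti (embDiag t + embAnti e) = (2 : ℤ) • e := by
  ext; simp [embDiag, embAnti, twiceAnti]; ring

theorem bLamK3_embDiag_add_embAnti (s t : TK3) (e f : Fin 8 → ℤ) :
    bLamK3 (embDiag s + embAnti e) (embDiag t + embAnti f) = bTK3 s t - 2 * bE8 e f := by
  simp [bLamK3_apply, bTK3_apply, embDiag, embAnti]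
  ring

theorem exists_eq_two_smul_linearMap {M N : Type*} [AddCommGroup M] [AddCommGroup N]
    [IsAddTorsionFree N] (L : M →ₗ[ℤ] N) (hL : ∀ x, ∃ y, L x = (2 : ℤ) • y) :
    ∃ G : M →ₗ[ℤ] N, ∀ x, L x = (2 : ℤ) • G x := by
  choose G hG using hL
  have inj : Function.Injective fun y : N => (2 : ℤ) • y := zsmul_right_injective two_ne_zero
  refine ⟨{ toFun := G, map_add' := fun x y => inj ?_, map_smul' := fun k x => inj ?_ }, hG⟩
  · simp only [smul_add, ← hG, map_add]
  · simp only [smul_comm (2 : ℤ), ← hG, map_smul, RingHom.id_apply]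

/-- Gluing: a map of `T` and a map of `E8(-2)` inducing the same map on `E8 / 2 E8` glue to
an endomorphism of `Λ`. -/
theorem exists_glue (φ : TK3 →ₗ[ℤ] TK3) (ψ : (Fin 8 → ℤ) →ₗ[ℤ] (Fin 8 → ℤ))
    (h : ∀ e, ∃ t, φ (inclE8 e) = inclE8 (ψ e) + (2 : ℤ) • t) :
    ∃ Φ : LamK3 →ₗ[ℤ] LamK3,
      ∀ x, (2 : ℤ) • Φ x = embDiag (φ (twiceProj x)) + embAnti (ψ (twiceAnti x)) := by
  obtain ⟨Φ, hΦ⟩ := exists_eq_two_smul_linearMap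
    (embDiag ∘ₗ φ ∘ₗ twiceProj + embAnti ∘ₗ ψ ∘ₗ twiceAnti) fun x => by
      obtain ⟨t, ht⟩ := h (twiceAnti x)
      have hx : twiceProj x = (2 : ℤ) • (x.1, x.2.2.1, x.2.2.2) + inclE8 (twiceAnti x) := by
        ext <;> simp [twiceProj, inclE8, twiceAnti]; ring
      refine ⟨embDiag (φ (x.1, x.2.2.1, x.2.2.2) + t) + (0, ψ (twiceAnti x), 0, 0), ?_⟩
      simp only [LinearMap.add_apply, LinearMap.comp_apply]
      rw [hx, map_add, map_smul, ht]
      ext <;> simp [embDiag, embAnti, inclE8] <;> ring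
  exact ⟨Φ, fun x => (hΦ x).symm⟩

theorem glue_comp_eq_id {φ φ' : TK3 →ₗ[ℤ] TK3} {ψ ψ' : (Fin 8 → ℤ) →ₗ[ℤ] (Fin 8 → ℤ)}
    {Φ Φ' : LamK3 →ₗ[ℤ] LamK3}
    (hΦ : ∀ x, (2 : ℤ) • Φ x = embDiag (φ (twiceProj x)) + embAnti (ψ (twiceAnti x)))
    (hΦ' : ∀ x, (2 : ℤ) • Φ' x = embDiag (φ' (twiceProj x)) + embAnti (ψ' (twiceAnti x)))
    (hφ : ∀ t, φ' (φ t) = t) (hψ : ∀ e, ψ' (ψ e) = e) : Φ' ∘ₗ Φ = LinearMap.id := by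
  refine LinearMap.ext fun x => zsmul_right_injective (n := 4) (by norm_num) ?_
  have h : (4 : ℤ) • Φ' (Φ x) = (2 : ℤ) • (2 : ℤ) • Φ' (Φ x) := by module
  simp only [LinearMap.comp_apply, LinearMap.id_apply]
  have hx : (4 : ℤ) • x = (2 : ℤ) • (2 : ℤ) • x := by module
  rw [h, hx, ← map_smul, hΦ, hΦ', twiceProj_embDiag_add_embAnti, twiceAnti_embDiag_add_embAnti,
    two_smul_eq_embDiag_add_embAnti x]
  simp only [map_smul, hφ, hψ, smul_add]

/-- **Extension of isometries from the invariant lattice.**  Every isometry `φ` of the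
invariant lattice `Λ^σ ≅ U³ ⊕ E8(-2) ⊕ ⟨-2⟩` (embedded diagonally via
`u ⊕ e ⊕ kδ ↦ u ⊕ e ⊕ e ⊕ kδ`) extends to an isometry `Φ` of
`Λ = U³ ⊕ E8(-1)² ⊕ ⟨-2⟩`. -/
theorem extend_isometry_from_invariant :
    ∀ φ : TK3 ≃ₗ[ℤ] TK3, (∀ s t : TK3, bTK3 (φ s) (φ t) = bTK3 s t) →
      ∃ Φ : LamK3 ≃ₗ[ℤ] LamK3,
        (∀ x y : LamK3, bLamK3 (Φ x) (Φ y) = bLamK3 x y)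
        ∧ (∀ t : TK3, Φ (embDiag t) = embDiag (φ t)) := by
  intro φ hφ
  let A : (Fin 8 → ℤ) →ₗ[ℤ] (Fin 8 → ℤ) :=
    LinearMap.fst ℤ _ _ ∘ₗ LinearMap.snd ℤ _ _ ∘ₗ φ.toLinearMap ∘ₗ inclE8
  have hA : ∀ e, ∃ u k, φ (inclE8 e) = ((2 : ℤ) • u, A e, 2 * k) := isometry_inclE8 hφ
  obtain ⟨ψ, hψ, hAψ⟩ := exists_isometry_congr A fun e => by
    obtain ⟨u, k, h⟩ := hA e
    obtain ⟨l, hl⟩ := bU3_self_even u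
    have := hφ (inclE8 e) (inclE8 e)
    rw [h, bTK3_apply, bTK3_apply] at this
    simp only [inclE8, LinearMap.coe_mk, AddHom.coe_mk, bE8_self, map_smul, map_zero,
      LinearMap.smul_apply, hl, smul_eq_mul] at this
    exact ⟨l - k ^ 2, by linarith⟩
  have hglue : ∀ e, ∃ t, φ (inclE8 e) = inclE8 (ψ e) + (2 : ℤ) • t := fun e => by
    obtain ⟨u, k, h⟩ := hA e
    obtain ⟨w, hw⟩ := hAψ e
    exact ⟨(u, w, k), by rw [h, hw]; simp [inclE8]⟩
  have hglue' : ∀ e, ∃ t, φ.symm (inclE8 e) = inclE8 (ψ.symm e) + (2 : ℤ) • t := fun e => by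
    obtain ⟨t, ht⟩ := hglue (ψ.symm e)
    refine ⟨-φ.symm t, φ.injective ?_⟩
    rw [φ.apply_symm_apply, map_add, map_smul, map_neg, φ.apply_symm_apply, ht, ψ.apply_symm_apply]
    module
  obtain ⟨Φ, hΦ⟩ := exists_glue φ.toLinearMap ψ.toLinearMap hglue
  obtain ⟨Φ', hΦ'⟩ := exists_glue φ.symm.toLinearMap ψ.symm.toLinearMap hglue'
  refine ⟨LinearEquiv.ofLinearMap Φ Φ' (glue_comp_eq_id hΦ' hΦ (by simp) (by simp))
    (glue_comp_eq_id hΦ hΦ' (by simp) (by simp)), fun x y => ?_, fun t => ?_⟩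
  · have h : bLamK3 ((2 : ℤ) • Φ x) ((2 : ℤ) • Φ y) = bLamK3 ((2 : ℤ) • x) ((2 : ℤ) • y) := by
      rw [hΦ, hΦ, two_smul_eq_embDiag_add_embAnti x, two_smul_eq_embDiag_add_embAnti y,
        bLamK3_embDiag_add_embAnti, bLamK3_embDiag_add_embAnti]
      simp [hφ, hψ]
    simp only [map_smul, LinearMap.smul_apply, smul_eq_mul] at h
    simp only [LinearEquiv.coe_ofLinearMap]
    linarith
  · apply zsmul_right_injective (two_ne_zero (α := ℤ))
    simp only [LinearEquiv.coe_ofLinearMap, hΦ]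
    have h1 := twiceProj_embDiag_add_embAnti t 0
    have h2 := twiceAnti_embDiag_add_embAnti t 0
    rw [map_zero, add_zero] at h1 h2
    rw [h1, h2, smul_zero, map_zero, map_zero, add_zero, map_smul, map_smul]
    rfl
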